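/- arXiv:2002.03336 — 5 statements merged into one kernel-verified Lean document; each statement's English description precedes it below -/
import Mathlib

section
/- Let m and k be positive natural numbers, and let v : ℤ × ℤ → ℕ be a double-indexed sequence satisfying the standard vanishing convention. Assume: (i) v(i,j) = 0 whenever j < k; (ii) v(m−i, j) = v(m+i, j) for all integers i, j; (iii) for every l ≥ 0, ∑_{i+j = m+k−l, i,j ≥ 0} v(i,j) = ∑_{i+j = m+k+l, i,j ≥ 0} v(i,j) (these antidiagonal sums are finite). Then v is a k-sequence, i.e. v(i,j) = 0 for all (i,j) with j ≠ k. (Proposition 2.1.) -/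
/-- The first moment about the midpoint of a function symmetric about that midpoint is zero. -/
theorem sum_Icc_moment_eq_zero (a b : ℤ) (f : ℤ → ℤ)
    (hf : ∀ x ∈ Finset.Icc a b, f (a + b - x) = f x) :
    ∑ x ∈ Finset.Icc a b, (2 * x - a - b) * f x = 0 := by
  have h : ∑ x ∈ Finset.Icc a b, (2 * x - a - b) * f x =
      ∑ x ∈ Finset.Icc a b, -((2 * x - a - b) * f x) := by
    refine Finset.sum_nbij' (fun x => a + b - x) (fun x => a + b - x) ?_ ?_ ?_ ?_ ?_
    · intro x hx
      simp only [Finset.mem_Icc] at hx ⊢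
      omega
    · intro x hx
      simp only [Finset.mem_Icc] at hx ⊢
      omega
    · intro x _
      ring
    · intro x _
      ring
    · intro x hx
      rw [hf x hx]
      ring
  rw [Finset.sum_neg_distrib] at h
  linarith

/-- Proposition 2.1: the first criterion for `k`-sequences.
A double-indexed sequence `v : ℤ × ℤ → ℕ` satisfying the standard vanishing
convention, which vanishes below row `k`, is symmetric about `i = m`, and whose
antidiagonal sums are symmetric about `m + k`, is a `k`-sequence. -/
theorem prop_2_1 (m k : ℕ) (hm : 0 < m) (hk : 0 < k) (v : ℤ × ℤ → ℕ)
    (hvanish : ∀ i j : ℤ, i < 0 ∨ j < 0 → v (i, j) = 0)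
    (h1 : ∀ i j : ℤ, j < (k : ℤ) → v (i, j) = 0)
    (h2 : ∀ i j : ℤ, v ((m : ℤ) - i, j) = v ((m : ℤ) + i, j))
    (h3 : ∀ l : ℕ,
      (∑ i ∈ Finset.Icc (0 : ℤ) ((m : ℤ) + k - l), v (i, ((m : ℤ) + k - l) - i)) =
      (∑ i ∈ Finset.Icc (0 : ℤ) ((m : ℤ) + k + l), v (i, ((m : ℤ) + k + l) - i))) :
    ∀ i j : ℤ, j ≠ (k : ℤ) → v (i, j) = 0 := by
  have hrefl : ∀ i j : ℤ, v (2 * m - i, j) = v (i, j) := fun i j => by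
    have := h2 (i - m) j
    rwa [show (m : ℤ) - (i - m) = 2 * m - i by ring, add_sub_cancel] at this
  have hright : ∀ i j : ℤ, 2 * (m : ℤ) < i → v (i, j) = 0 := fun i j hi => by
    rw [← hrefl]
    exact hvanish _ _ (Or.inl (by omega))
  have hdiag : ∀ d : ℤ, ∑ i ∈ Finset.Icc (0 : ℤ) d, v (i, d - i) =
      ∑ i ∈ Finset.Icc (0 : ℤ) (2 * m), v (i, d - i) := fun d => by
    refine Finset.sum_congr_of_eq_on_inter ?_ ?_ (fun _ _ _ => rfl)
    · intro i hi hi'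
      simp only [Finset.mem_Icc] at hi hi'
      exact hright _ _ (by omega)
    · intro i hi hi'
      simp only [Finset.mem_Icc] at hi hi'
      exact h1 _ _ (by omega)
  simp only [hdiag] at h3
  have htop : ∀ i j : ℤ, 2 * (m : ℤ) + k < i + j → v (i, j) = 0 := fun i j hij => by
    by_cases hi : i ∈ Finset.Icc (0 : ℤ) (2 * m)
    · obtain ⟨l, hl⟩ := Int.eq_ofNat_of_zero_le (show 0 ≤ i + j - m - k by omega)
      have hsum := h3 l
      rw [Finset.sum_eq_zero, eq_comm, Finset.sum_eq_zero_iff] at hsum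
      · have := hsum i hi
        rwa [show (m : ℤ) + k + l - i = j by omega] at this
      · intro x hx
        simp only [Finset.mem_Icc] at hx
        exact h1 _ _ (by omega)
    · simp only [Finset.mem_Icc] at hi
      by_cases h : i < 0
      · exact hvanish _ _ (Or.inl h)
      · exact hright _ _ (by omega)
  have hdsymm : ∀ d : ℤ, ∑ i ∈ Finset.Icc (0 : ℤ) (2 * m), v (i, k + (k + 2 * m) - d - i) =
      ∑ i ∈ Finset.Icc (0 : ℤ) (2 * m), v (i, d - i) := fun d => by
    have h := h3 (d - m - k).natAbs
    rcases le_total 0 (d - m - k) with hd | hd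
    · rw [show (m : ℤ) + k - (d - m - k).natAbs = k + (k + 2 * m) - d by omega,
        show (m : ℤ) + k + (d - m - k).natAbs = d by omega] at h
      exact h
    · rw [show (m : ℤ) + k + (d - m - k).natAbs = k + (k + 2 * m) - d by omega,
        show (m : ℤ) + k - (d - m - k).natAbs = d by omega] at h
      exact h.symm
  have hcol : ∀ i ∈ Finset.Icc (0 : ℤ) (2 * m),
      ∑ d ∈ Finset.Icc (k : ℤ) (k + 2 * m), v (i, d - i) = ∑ᶠ j, v (i, j) := fun i hi => by
    rw [← finsum_comp_equiv (Equiv.subRight i), eq_comm]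
    refine finsum_eq_sum_of_support_subset _ fun d hd => ?_
    simp only [Finset.mem_Icc] at hi
    simp only [Function.mem_support, Equiv.subRight_apply] at hd
    simp only [Finset.coe_Icc, Set.mem_Icc]
    by_contra hc
    by_cases h : d < k
    · exact hd (h1 _ _ (by omega))
    · exact hd (htop _ _ (by omega))
  have hA := sum_Icc_moment_eq_zero k (k + 2 * m)
    (fun d => ((∑ i ∈ Finset.Icc (0 : ℤ) (2 * m), v (i, d - i) : ℕ) : ℤ))
    (fun d _ => congrArg Nat.cast (hdsymm d))
  have hB := sum_Icc_moment_eq_zero 0 (2 * m)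
    (fun i => ((∑ d ∈ Finset.Icc (k : ℤ) (k + 2 * m), v (i, d - i) : ℕ) : ℤ))
    (fun i hi => by
      have hi' : 0 + 2 * (m : ℤ) - i ∈ Finset.Icc (0 : ℤ) (2 * m) := by
        simp only [Finset.mem_Icc] at hi ⊢
        omega
      rw [hcol _ hi, hcol _ hi']
      simp only [zero_add, hrefl])
  simp only [Nat.cast_sum, Finset.mul_sum] at hA hB
  rw [Finset.sum_comm] at hA
  have hrow : ∑ i ∈ Finset.Icc (0 : ℤ) (2 * m), ∑ d ∈ Finset.Icc (k : ℤ) (k + 2 * m),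
      2 * (d - i - k) * (v (i, d - i) : ℤ) = 0 := by
    refine Eq.trans ?_ ((congrArg₂ (· - ·) hA hB).trans (sub_zero 0))
    simp only [← Finset.sum_sub_distrib]
    refine Finset.sum_congr rfl fun i _ => Finset.sum_congr rfl fun d _ => ?_
    ring
  have hnonneg : ∀ i d : ℤ, 0 ≤ 2 * (d - i - k) * (v (i, d - i) : ℤ) := fun i d => by
    by_cases h : d - i < k
    · simp [h1 _ _ h]
    · exact mul_nonneg (by omega) (by positivity)
  intro i j hj
  by_contra hv
  have hik : 0 ≤ i ∧ i ≤ 2 * m ∧ k ≤ j ∧ i + j ≤ 2 * m + k := by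
    refine ⟨?_, ?_, ?_, ?_⟩ <;> by_contra h
    · exact hv (hvanish _ _ (by omega))
    · exact hv (hright _ _ (by omega))
    · exact hv (h1 _ _ (by omega))
    · exact hv (htop _ _ (by omega))
  rw [Finset.sum_eq_zero_iff_of_nonneg
    (fun i _ => Finset.sum_nonneg fun d _ => hnonneg i d)] at hrow
  have hi := hrow i (Finset.mem_Icc.2 (by omega))
  rw [Finset.sum_eq_zero_iff_of_nonneg (fun d _ => hnonneg i d)] at hi
  have hij := hi (i + j) (Finset.mem_Icc.2 (by omega))
  rw [add_sub_cancel_left] at hij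
  rcases mul_eq_zero.1 hij with h | h
  · omega
  · exact hv (by exact_mod_cast h)
end

section
/- Let m and k be positive natural numbers, and let v : ℤ × ℤ → ℕ be a finitely supported double-indexed sequence satisfying the standard vanishing convention. Assume: (i) v(i,j) = v(2m+2k−i−2j, j) for all integers i, j; (ii) for every l ≥ 0, ∑_{i+j = k+l, i,j ≥ 0} v(i,j) = ∑_{j ≥ 0} v(l,j); (iii) for every i ≥ 0, ∑_{j ≥ 0} v(m+i, j) = ∑_{j ≥ 0} v(m−i, j). Then v is a k-sequence, i.e. v(i,j) = 0 for all (i,j) with j ≠ k. (Proposition 2.2.) -/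
/-- Summing `f (e.symm p).1` against a finitely supported weight `v` only involves the
sums of `v` over the images under `e` of the lines `{a} × ℤ`. -/
lemma finsum_fiberwise_mul (v : ℤ × ℤ → ℕ) (hfin : (Function.support v).Finite)
    (e : ℤ × ℤ ≃ ℤ × ℤ) (f : ℤ → ℤ) :
    ∑ᶠ p, f (e.symm p).1 * (v p : ℤ) = ∑ᶠ a, f a * ((∑ᶠ b, v (e (a, b)) : ℕ) : ℤ) := by
  have hfin' : (Function.support fun p => v (e p)).Finite :=
    hfin.preimage e.injective.injOn
  rw [← finsum_comp_equiv e, finsum_curry]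
  · refine finsum_congr fun a => ?_
    have hrow : (Function.support fun b => v (e (a, b))).Finite :=
      hfin'.preimage (f := fun b : ℤ => (a, b)) (Prod.mk_right_injective a).injOn
    have hcast : ((∑ᶠ b, v (e (a, b)) : ℕ) : ℤ) = ∑ᶠ b, (v (e (a, b)) : ℤ) :=
      (Nat.castAddMonoidHom ℤ).map_finsum hrow
    rw [hcast, mul_finsum]
    simp
  · refine hfin'.subset fun p hp => ?_
    simp only [Function.mem_support, ne_eq, mul_eq_zero, not_or] at hp ⊢
    exact_mod_cast hp.2

/-- The shear of `ℤ × ℤ` whose columns are the antidiagonals. -/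
def antidiagonalShear : ℤ × ℤ ≃ ℤ × ℤ where
  toFun p := (p.2, p.1 - p.2)
  invFun p := (p.1 + p.2, p.1)
  left_inv p := by simp
  right_inv p := by simp

/-- The reflection of each line `j = const` about `i = c - j`. -/
def shearedReflection (c : ℤ) : ℤ × ℤ ≃ ℤ × ℤ where
  toFun p := (2 * c - p.1 - 2 * p.2, p.2)
  invFun p := (2 * c - p.1 - 2 * p.2, p.2)
  left_inv p := by ext <;> simp; ring
  right_inv p := by ext <;> simp; ring

/-- The antidiagonal sums inherit a reflection symmetry from the one of the sequence. -/
lemma finsum_antidiagonal_symm (v : ℤ × ℤ → ℕ) (c : ℤ)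
    (hsymm : ∀ i j : ℤ, v (i, j) = v (2 * c - i - 2 * j, j)) (d : ℤ) :
    ∑ᶠ i : ℤ, v (i, d - i) = ∑ᶠ i : ℤ, v (i, 2 * c - d - i) := by
  symm
  rw [← finsum_comp_equiv (Equiv.addRight (2 * c - 2 * d))]
  refine finsum_congr fun i => ?_
  rw [hsymm i (d - i)]
  simp only [Equiv.coe_addRight]
  congr 2 <;> ring

/-- Under the vanishing convention, the antidiagonal sum may be taken over all of `ℤ`. -/
lemma finsum_antidiagonal_eq_sum (v : ℤ × ℤ → ℕ)
    (hvanish : ∀ i j : ℤ, i < 0 ∨ j < 0 → v (i, j) = 0) (d : ℤ) :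
    ∑ᶠ i : ℤ, v (i, d - i) = ∑ i ∈ Finset.Icc (0 : ℤ) d, v (i, d - i) := by
  refine finsum_eq_sum_of_support_subset _ fun i hi => ?_
  by_contra hmem
  rw [Finset.coe_Icc, Set.mem_Icc] at hmem
  exact hi (hvanish _ _ (by omega))

/-- The antidiagonal sums agree with the row sums shifted by `k`, at every integer. -/
lemma finsum_antidiagonal_eq_finsum_row (m k : ℕ) (v : ℤ × ℤ → ℕ)
    (hvanish : ∀ i j : ℤ, i < 0 ∨ j < 0 → v (i, j) = 0)
    (h1 : ∀ i j : ℤ, v (i, j) = v (2 * (m : ℤ) + 2 * k - i - 2 * j, j))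
    (h2 : ∀ l : ℕ,
      (∑ i ∈ Finset.Icc (0 : ℤ) ((k : ℤ) + l), v (i, ((k : ℤ) + l) - i)) =
      ∑ᶠ j : ℤ, v ((l : ℤ), j))
    (h3 : ∀ i : ℕ,
      (∑ᶠ j : ℤ, v ((m : ℤ) + i, j)) = ∑ᶠ j : ℤ, v ((m : ℤ) - i, j)) (l : ℤ) :
    ∑ᶠ i : ℤ, v (i, k + l - i) = ∑ᶠ j : ℤ, v (l, j) := by
  have hnonneg (n : ℕ) : ∑ᶠ i : ℤ, v (i, k + n - i) = ∑ᶠ j : ℤ, v ((n : ℤ), j) :=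
    (finsum_antidiagonal_eq_sum v hvanish _).trans (h2 n)
  have hneg (a : ℤ) (ha : a < 0) : ∑ᶠ j : ℤ, v (a, j) = 0 := by
    simp [hvanish a _ (Or.inl ha)]
  rcases le_or_gt 0 l with hl | hl
  · lift l to ℕ using hl
    exact hnonneg l
  · obtain ⟨n, hn⟩ := Int.eq_ofNat_of_zero_le (show 0 ≤ 2 * (m : ℤ) - l by omega)
    obtain ⟨i, hi⟩ := Int.eq_ofNat_of_zero_le (show 0 ≤ (m : ℤ) - l by omega)
    rw [hneg l hl, finsum_antidiagonal_symm v (m + k) (fun i j => by rw [h1 i j, mul_add]),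
      show 2 * ((m : ℤ) + k) - (k + l) = k + n by omega, hnonneg n,
      show (n : ℤ) = m + i by omega, h3 i]
    exact hneg _ (by omega)

/-- Proposition 2.2: the second criterion for `k`-sequences.
A finitely supported double-indexed sequence `v : ℤ × ℤ → ℕ` satisfying the
standard vanishing convention, the symmetry `v(i,j) = v(2m+2k-i-2j, j)`, whose
antidiagonal sums over `i+j = k+l` equal the row sums `∑_j v(l,j)`, and whose
row sums are symmetric about `m`, is a `k`-sequence. -/
theorem prop_2_2 (m k : ℕ) (hm : 0 < m) (hk : 0 < k) (v : ℤ × ℤ → ℕ)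
    (hfin : (Function.support v).Finite)
    (hvanish : ∀ i j : ℤ, i < 0 ∨ j < 0 → v (i, j) = 0)
    (h1 : ∀ i j : ℤ, v (i, j) = v (2 * (m : ℤ) + 2 * k - i - 2 * j, j))
    (h2 : ∀ l : ℕ,
      (∑ i ∈ Finset.Icc (0 : ℤ) ((k : ℤ) + l), v (i, ((k : ℤ) + l) - i)) =
      ∑ᶠ j : ℤ, v ((l : ℤ), j))
    (h3 : ∀ i : ℕ,
      (∑ᶠ j : ℤ, v ((m : ℤ) + i, j)) = ∑ᶠ j : ℤ, v ((m : ℤ) - i, j)) :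
    ∀ i j : ℤ, j ≠ (k : ℤ) → v (i, j) = 0 := by
  have hsum (g : ℤ × ℤ → ℤ) :
      ∑ᶠ p, g p * (v p : ℤ) = ∑ p ∈ hfin.toFinset, g p * (v p : ℤ) := by
    refine finsum_eq_sum_of_support_subset _ fun p hp => ?_
    simp only [Function.mem_support, ne_eq, mul_eq_zero, not_or] at hp
    simpa using hp.2
  have hrow := finsum_fiberwise_mul v hfin (Equiv.refl _) fun a => (a - m) ^ 2
  have hdiag := finsum_fiberwise_mul v hfin antidiagonalShear fun a => (a - m - k) ^ 2
  have hmoment : ∑ᶠ p : ℤ × ℤ, (p.1 + p.2 - m - k) ^ 2 * (v p : ℤ) =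
      ∑ᶠ p : ℤ × ℤ, (p.1 - m) ^ 2 * (v p : ℤ) := by
    refine hdiag.trans (Eq.trans ?_ hrow.symm)
    rw [← finsum_comp_equiv (Equiv.addLeft (k : ℤ))]
    refine finsum_congr fun l => ?_
    have hl := finsum_antidiagonal_eq_finsum_row m k v hvanish h1 h2 h3 l
    simp only [antidiagonalShear, Equiv.coe_fn_mk, Equiv.coe_addLeft, Equiv.refl_apply, hl]
    ring
  have hcross : ∑ᶠ p : ℤ × ℤ, ((p.1 + p.2 - m - k) * (p.2 - k)) * (v p : ℤ) = 0 := by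
    have hodd : ∑ᶠ p : ℤ × ℤ, ((p.1 + p.2 - m - k) * (p.2 - k)) * (v p : ℤ) =
        ∑ᶠ p : ℤ × ℤ, (-((p.1 + p.2 - m - k) * (p.2 - k))) * (v p : ℤ) := by
      rw [← finsum_comp_equiv (shearedReflection (m + k))]
      refine finsum_congr fun p => ?_
      simp only [shearedReflection, Equiv.coe_fn_mk, mul_add]
      rw [← h1 p.1 p.2]
      ring
    simp only [neg_mul, finsum_neg_distrib] at hodd
    omega
  have hsq : ∑ p ∈ hfin.toFinset, (p.2 - k : ℤ) ^ 2 * (v p : ℤ) = 0 := by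
    rw [hsum, hsum] at hmoment
    rw [hsum] at hcross
    calc ∑ p ∈ hfin.toFinset, (p.2 - k : ℤ) ^ 2 * (v p : ℤ)
        = ∑ p ∈ hfin.toFinset, (p.1 - m : ℤ) ^ 2 * (v p : ℤ)
          - ∑ p ∈ hfin.toFinset, (p.1 + p.2 - m - k : ℤ) ^ 2 * (v p : ℤ)
          + 2 * ∑ p ∈ hfin.toFinset, ((p.1 + p.2 - m - k) * (p.2 - k) : ℤ) * (v p : ℤ) := by
          rw [Finset.mul_sum, ← Finset.sum_sub_distrib, ← Finset.sum_add_distrib]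
          exact Finset.sum_congr rfl fun p _ => by ring
      _ = 0 := by rw [hmoment, hcross]; ring
  intro i j hj
  by_contra hv
  have hterm := (Finset.sum_eq_zero_iff_of_nonneg fun p _ => by positivity).1 hsq (i, j)
    (by simpa using hv)
  rcases mul_eq_zero.1 hterm with h | h
  · exact hj (sub_eq_zero.1 (pow_eq_zero_iff two_ne_zero |>.1 h))
  · exact hv (by exact_mod_cast h)
end

section
/- Let m and k be positive natural numbers, and let v : ℤ × ℤ → ℕ be a finitely supported double-indexed sequence satisfying the standard vanishing convention. Assume hypotheses (i) v(i,j) = v(2m+2k−i−2j, j) for all integers i, j, and (iii) ∑_{j ≥ 0} v(m+i, j) = ∑_{j ≥ 0} v(m−i, j) for every i ≥ 0. Then v(i,j) = 0 whenever i + j < k, and v(i, k−i) = 0 for every i > 0. (The induction base established in the proof of Proposition 2.2.) -/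
/-- The induction base established in the proof of Proposition 2.2:
under hypotheses (i) and (iii) of Proposition 2.2, `v(i,j) = 0` whenever
`i + j < k`, and `v(i, k - i) = 0` for every `i > 0`. -/
theorem prop_2_2_base (m k : ℕ) (hm : 0 < m) (hk : 0 < k) (v : ℤ × ℤ → ℕ)
    (hfin : (Function.support v).Finite)
    (hvanish : ∀ i j : ℤ, i < 0 ∨ j < 0 → v (i, j) = 0)
    (h1 : ∀ i j : ℤ, v (i, j) = v (2 * (m : ℤ) + 2 * k - i - 2 * j, j))
    (h3 : ∀ i : ℕ,
      (∑ᶠ j : ℤ, v ((m : ℤ) + i, j)) = ∑ᶠ j : ℤ, v ((m : ℤ) - i, j)) :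
    (∀ i j : ℤ, i + j < (k : ℤ) → v (i, j) = 0) ∧
      (∀ i : ℤ, 0 < i → v (i, (k : ℤ) - i) = 0) := by
  have hcol : ∀ i j : ℤ, 2 * (m : ℤ) < i → v (i, j) = 0 := by
    intro i j hi
    have hsum := h3 (i - m).toNat
    have hleft : (m : ℤ) + ((i - m).toNat : ℤ) = i := by omega
    have hright : ∀ l : ℤ, v ((m : ℤ) - ((i - m).toNat : ℤ), l) = 0 :=
      fun l => hvanish _ _ (Or.inl (by omega))
    simp only [hleft, hright, finsum_zero] at hsum
    have hsupp : (Function.support fun l : ℤ => v (i, l)).Finite :=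
      hfin.preimage (f := fun l : ℤ => (i, l)) (Prod.mk_right_injective i).injOn
    have hle := single_le_finsum j hsupp fun _ => Nat.zero_le _
    exact Nat.le_zero.mp (hle.trans hsum.le)
  have hlow : ∀ i j : ℤ, i + 2 * j < 2 * (k : ℤ) → v (i, j) = 0 := by
    intro i j hij
    rw [h1]
    exact hcol _ _ (by omega)
  refine ⟨fun i j hij => ?_, fun i hi => hlow _ _ (by omega)⟩
  by_cases hi : i < 0
  · exact hvanish _ _ (Or.inl hi)
  · exact hlow _ _ (by omega)
end

section
/- Let n be a prime number and g ≥ 2 an integer. For every nonzero rational number q, one has E(q) = q^{(2g−2)(2n²+n−3)} · E(1/q), where E is the rational function E(q) = ((n^{2g} − 1)/n) · q^{(n²−1)(2g−2)} · ((q − 1)^{(n−1)(2g−2)} − (1 + q + ⋯ + q^{n−1})^{2g−2}). (Equation (2.11)/(E11): E(q) is palindromic.) -/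
/-- The geometric sum `1 + q + ⋯ + q ^ m` is palindromic. -/
theorem pow_mul_geom_sum_one_div {K : Type*} [Field K] {q : K} (hq : q ≠ 0) (m : ℕ) :
    q ^ m * ∑ i ∈ Finset.range (m + 1), (1 / q) ^ i = ∑ i ∈ Finset.range (m + 1), q ^ i := by
  rw [← Finset.sum_range_reflect (fun i => q ^ i), Finset.mul_sum]
  refine Finset.sum_congr rfl fun i hi => ?_
  have him : i ≤ m := Nat.lt_succ_iff.mp (Finset.mem_range.mp hi)
  rw [Nat.add_sub_cancel, pow_sub₀ q hq him, one_div, inv_pow]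

/-- An even power of `q - 1` is palindromic. -/
theorem pow_mul_one_div_sub_one_pow {K : Type*} [Field K] {q : K} (hq : q ≠ 0) {d : ℕ}
    (hd : Even d) : q ^ d * (1 / q - 1) ^ d = (q - 1) ^ d := by
  rw [← mul_pow, mul_sub, mul_one_div_cancel hq, mul_one, ← neg_sub, hd.neg_pow]

/-- Equation (E11): the rational function
`E(q) = ((n^{2g} - 1)/n) · q^{(n²-1)(2g-2)} · ((q-1)^{(n-1)(2g-2)} - (1+q+⋯+q^{n-1})^{2g-2})`
is palindromic: `E(q) = q^{(2g-2)(2n²+n-3)} · E(1/q)` for every nonzero rational `q`. -/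
theorem E_palindromic (n g : ℕ) (hn : n.Prime) (hg : 2 ≤ g) (q : ℚ) (hq : q ≠ 0) :
    (((n : ℚ) ^ (2 * g) - 1) / n) * q ^ ((n ^ 2 - 1) * (2 * g - 2)) *
        ((q - 1) ^ ((n - 1) * (2 * g - 2)) -
          (∑ i ∈ Finset.range n, q ^ i) ^ (2 * g - 2)) =
      q ^ ((2 * g - 2) * (2 * n ^ 2 + n - 3)) *
        ((((n : ℚ) ^ (2 * g) - 1) / n) * (1 / q) ^ ((n ^ 2 - 1) * (2 * g - 2)) *
          ((1 / q - 1) ^ ((n - 1) * (2 * g - 2)) -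
            (∑ i ∈ Finset.range n, (1 / q) ^ i) ^ (2 * g - 2))) := by
  obtain ⟨m, rfl⟩ : ∃ m, n = m + 1 := ⟨n - 1, (Nat.succ_pred_eq_of_pos hn.pos).symm⟩
  have hk : Even (2 * g - 2) := ⟨g - 1, by omega⟩
  generalize 2 * g - 2 = k at hk ⊢
  have ha : (m + 1) ^ 2 - 1 = m * (m + 2) := by
    rw [Nat.sub_eq_iff_eq_add (Nat.one_le_pow 2 (m + 1) m.succ_pos)]
    ring
  have hexp : k * (2 * (m + 1) ^ 2 + (m + 1) - 3) =
      m * (m + 2) * k + m * (m + 2) * k + m * k := by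
    rw [show 2 * (m + 1) ^ 2 + (m + 1) - 3 = 2 * (m * (m + 2)) + m by
      rw [Nat.sub_eq_iff_eq_add (by nlinarith)]
      ring]
    ring
  rw [ha, hexp, Nat.add_sub_cancel, ← pow_mul_one_div_sub_one_pow hq (hk.mul_left m),
    ← pow_mul_geom_sum_one_div hq m, mul_pow, ← pow_mul, pow_add, pow_add]
  have hcancel : q ^ (m * (m + 2) * k) * (1 / q) ^ (m * (m + 2) * k) = 1 := by
    rw [← mul_pow, mul_one_div_cancel hq, one_pow]
  generalize (1 / q) ^ (m * (m + 2) * k) = b at hcancel ⊢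
  generalize q ^ (m * (m + 2) * k) = a at hcancel ⊢
  generalize (1 / q - 1) ^ (m * k) = u
  generalize (∑ i ∈ Finset.range (m + 1), (1 / q) ^ i) ^ k = v
  generalize (((m + 1 : ℕ) : ℚ) ^ (2 * g) - 1) / ((m + 1 : ℕ) : ℚ) = c
  linear_combination (-(c * a * q ^ (m * k) * (u - v))) * hcancel
end

section
/- Let n be a prime number and g ≥ 2 an integer. For every nonzero rational number q, one has E(1/q) · q^{2·(n²−1)(2g−2)} = (E(q) · q^{−(n²+n−2)(g−1)}) · q^{n(n−1)(g−1)}, where E(q) = ((n^{2g} − 1)/n) · q^{(n²−1)(2g−2)} · ((q − 1)^{(n−1)(2g−2)} − (1 + q + ⋯ + q^{n−1})^{2g−2}). (Equation (3.23), the identity E(1/q)·q^{2 dim(M_B)} = E_var(M_B; √q, √q)·q^{c_n}, with E_var(M_B; √q, √q) replaced via Proposition 3.5 by E(q)·q^{−(n²+n−2)(g−1)} and c_n = n(n−1)(g−1).) -/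
/-- Reversal of a geometric sum under inversion of the ratio. -/
theorem sum_range_succ_inv_pow_mul_pow {K : Type*} [Field K] {q : K} (hq : q ≠ 0) (m : ℕ) :
    (∑ i ∈ Finset.range (m + 1), (1 / q) ^ i) * q ^ m = ∑ i ∈ Finset.range (m + 1), q ^ i := by
  rw [← Finset.sum_range_reflect (fun i => q ^ i), Finset.sum_mul]
  refine Finset.sum_congr rfl fun i hi => ?_
  have him : i ≤ m := Nat.lt_succ_iff.mp (Finset.mem_range.mp hi)
  rw [Nat.add_sub_cancel, pow_sub₀ q hq him, one_div, inv_pow, mul_comm]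

/-- An even power of `q⁻¹ - 1`, cleared of denominators. -/
theorem one_div_sub_one_pow_mul_pow {K : Type*} [Field K] {q : K} (hq : q ≠ 0) {e : ℕ}
    (he : Even e) : (1 / q - 1) ^ e * q ^ e = (q - 1) ^ e := by
  rw [← mul_pow, sub_mul, one_div_mul_cancel hq, one_mul, ← neg_sub, he.neg_pow]

/-- Equation (3.23): for every nonzero rational `q`,
`E(1/q) · q^{2·(n²-1)(2g-2)} = (E(q) · q^{-(n²+n-2)(g-1)}) · q^{n(n-1)(g-1)}`,
where `E` is the polynomial of equation (E1). -/
theorem E_eq_3_23 (n g : ℕ) (hn : n.Prime) (hg : 2 ≤ g) (q : ℚ) (hq : q ≠ 0) :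
    ((((n : ℚ) ^ (2 * g) - 1) / n) * (1 / q) ^ ((n ^ 2 - 1) * (2 * g - 2)) *
          ((1 / q - 1) ^ ((n - 1) * (2 * g - 2)) -
            (∑ i ∈ Finset.range n, (1 / q) ^ i) ^ (2 * g - 2))) *
        q ^ (2 * ((n ^ 2 - 1) * (2 * g - 2))) =
      ((((n : ℚ) ^ (2 * g) - 1) / n) * q ^ ((n ^ 2 - 1) * (2 * g - 2)) *
            ((q - 1) ^ ((n - 1) * (2 * g - 2)) -
              (∑ i ∈ Finset.range n, q ^ i) ^ (2 * g - 2)) *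
          q ^ (-(((n ^ 2 + n - 2) * (g - 1) : ℕ) : ℤ))) *
        q ^ (n * (n - 1) * (g - 1)) := by
  obtain ⟨m, rfl⟩ : ∃ m, n = m + 1 := ⟨n - 1, by have := hn.pos; omega⟩
  obtain ⟨k, rfl⟩ : ∃ k, g = k + 1 := ⟨g - 1, by omega⟩
  have hk : 2 * (k + 1) - 2 = 2 * k := by omega
  have hc : ((m + 1) ^ 2 + (m + 1) - 2) * k = (m + 1) * m * k + m * (2 * k) := by
    rw [show (m + 1) ^ 2 + (m + 1) - 2 = (m + 1) * m + m * 2 by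
      rw [Nat.sub_eq_iff_eq_add (by nlinarith)]; ring]
    ring
  simp only [hk, Nat.add_sub_cancel, hc]
  rw [← one_div_sub_one_pow_mul_pow hq (e := m * (2 * k)) ((even_two_mul k).mul_left m),
    ← sum_range_succ_inv_pow_mul_pow hq m, mul_pow, ← pow_mul, ← sub_mul,
    zpow_neg, zpow_natCast, pow_add, two_mul ((_ - 1) * (2 * k)), pow_add, one_div, inv_pow]
  field_simp
end
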